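/- There is no Singleton-optimal $(2,3)$-LRC over $GF(4)$ with even dimension $k = 2\ell$ and minimum distance $d = 4$. -/

import Mathlib

open scoped Classical

/-- Hamming weight of a vector. -/
noncomputable def wt {ι F : Type*} [Fintype ι] [Zero F] (x : ι → F) : ℕ :=
  (Finset.univ.filter (fun i => x i ≠ 0)).card

/-- Minimum distance of a linear code (minimum weight of a nonzero codeword). -/
noncomputable def minDist {ι F : Type*} [Fintype ι] [Field F]
    (C : Submodule F (ι → F)) : ℕ :=
  sInf {w | ∃ c ∈ C, c ≠ 0 ∧ wt c = w}

/-- Restriction (puncturing) of a code to the coordinates in `S`. -/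
noncomputable def puncture {ι F : Type*} [Fintype ι] [Field F]
    (C : Submodule F (ι → F)) (S : Finset ι) : Submodule F (↥S → F) :=
  C.map (LinearMap.funLeft F F (fun i : ↥S => (i : ι)))

/-- `C` is an `(r, δ)` locally repairable code with repair groups `R`:
the groups cover all coordinates, each has size at most `r + δ - 1`, and
each local (punctured) code has minimum distance at least `δ`. -/
def IsLRC {ι F : Type*} [Fintype ι] [Field F]
    (C : Submodule F (ι → F)) (r δ : ℕ) (R : Finset (Finset ι)) : Prop :=
  (∀ i : ι, ∃ S ∈ R, i ∈ S) ∧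
  (∀ S ∈ R, S.card ≤ r + δ - 1) ∧
  (∀ S ∈ R, ∀ c ∈ puncture C S, c ≠ 0 → δ ≤ wt c)

/-- No coordinate of the code is identically zero. -/
def NoZeroCoord {ι F : Type*} [Fintype ι] [Field F]
    (C : Submodule F (ι → F)) : Prop :=
  ∀ i : ι, ∃ c ∈ C, c i ≠ 0

/-- The Singleton-type bound for `(r, δ)`-LRCs is attained with equality:
`d = n - k + 1 - (⌈k/r⌉ - 1)(δ - 1)`. -/
def SingletonOptimal {ι F : Type*} [Fintype ι] [Field F]
    (C : Submodule F (ι → F)) (r δ : ℕ) : Prop :=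
  (minDist C : ℤ) = (Fintype.card ι : ℤ) - (Module.finrank F C : ℤ) + 1 -
    ((((Module.finrank F C + r - 1) / r : ℕ) : ℤ) - 1) * ((δ : ℤ) - 1)

/-- The dual code of `C` with respect to the standard bilinear form. -/
noncomputable def dualCode {ι F : Type*} [Fintype ι] [Field F]
    (C : Submodule F (ι → F)) : Submodule F (ι → F) where
  carrier := {x | ∀ c ∈ C, ∑ i, x i * c i = 0}
  add_mem' := by
    intro a b ha hb c hc
    simp only [Set.mem_setOf_eq] at ha hb ⊢
    simp [Pi.add_apply, add_mul, Finset.sum_add_distrib, ha c hc, hb c hc]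
  zero_mem' := by
    intro c hc
    simp
  smul_mem' := by
    intro t a ha c hc
    simp only [Set.mem_setOf_eq] at ha ⊢
    simp [Pi.smul_apply, smul_eq_mul, mul_assoc, ← Finset.mul_sum, ha c hc]

/-- Support of a (sub)code: coordinates where some codeword is nonzero. -/
noncomputable def codeSupp {ι F : Type*} [Fintype ι] [Field F]
    (D : Submodule F (ι → F)) : Finset ι :=
  Finset.univ.filter (fun i => ∃ x ∈ D, x i ≠ 0)

/-- Codewords vanishing on `T`. -/
noncomputable def KK {n : ℕ} {F : Type*} [Field F] (C : Submodule F (Fin n → F))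
    (T : Finset (Fin n)) : Submodule F (Fin n → F) :=
  C ⊓ ⨅ i ∈ T, LinearMap.ker (LinearMap.proj i : (Fin n → F) →ₗ[F] F)

theorem mem_KK {n : ℕ} {F : Type*} [Field F] (C : Submodule F (Fin n → F))
    (T : Finset (Fin n)) (c : Fin n → F) : c ∈ KK C T ↔ c ∈ C ∧ ∀ i ∈ T, c i = 0 := by
  simp [KK]

theorem KK_anti {n : ℕ} {F : Type*} [Field F] (C : Submodule F (Fin n → F))
    {T U : Finset (Fin n)} (h : T ⊆ U) : KK C U ≤ KK C T := by
  intro c hc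
  rw [mem_KK] at hc ⊢
  exact ⟨hc.1, fun i hi => hc.2 i (h hi)⟩

theorem KK_insert {n : ℕ} {F : Type*} [Field F] (C : Submodule F (Fin n → F))
    (T : Finset (Fin n)) (i : Fin n) :
    Module.finrank F (KK C T) ≤ Module.finrank F (KK C (insert i T)) + 1 := by
  let f : KK C T →ₗ[F] F := (LinearMap.proj i).comp (KK C T).subtype
  have h1 := LinearMap.finrank_range_add_finrank_ker f
  have h2 : Module.finrank F (LinearMap.range f) ≤ 1 := by
    simpa using Submodule.finrank_le (LinearMap.range f)
  have h3 : Module.finrank F (LinearMap.ker f) ≤ Module.finrank F (KK C (insert i T)) := by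
    rw [← Submodule.finrank_map_subtype_eq (KK C T) (LinearMap.ker f)]
    apply Submodule.finrank_mono
    rintro c ⟨⟨d, hd⟩, hdk, rfl⟩
    have h0 : d i = 0 := hdk
    rw [mem_KK] at hd
    change d ∈ KK C (insert i T)
    rw [mem_KK]
    refine ⟨hd.1, fun j hj => ?_⟩
    rcases Finset.mem_insert.1 hj with rfl | hj
    · exact h0
    · exact hd.2 j hj
  omega

theorem KK_union {n : ℕ} {F : Type*} [Field F] (C : Submodule F (Fin n → F))
    (T A : Finset (Fin n)) :
    Module.finrank F (KK C T) ≤ Module.finrank F (KK C (T ∪ A)) + A.card := by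
  induction A using Finset.induction_on with
  | empty => rw [Finset.union_empty]; omega
  | insert a A ha ih =>
    rw [Finset.card_insert_of_notMem ha, Finset.union_insert]
    have := KK_insert C (T ∪ A) a
    omega

theorem group_zero {n : ℕ} {F : Type*} [Field F] (C : Submodule F (Fin n → F))
    (R : Finset (Finset (Fin n))) (hLRC : IsLRC C 2 3 R) (S : Finset (Fin n)) (hS : S ∈ R)
    (B : Finset (Fin n)) (hB : B.card ≤ 2) (c : Fin n → F) (hc : c ∈ C)
    (hz : ∀ i ∈ S, i ∉ B → c i = 0) : ∀ i ∈ S, c i = 0 := by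
  by_contra hne
  push Not at hne
  obtain ⟨i, hi, hci⟩ := hne
  have h := hLRC.2.2 S hS (fun j : ↥S => c j) ⟨c, hc, rfl⟩
    (fun h0 => hci (congrFun h0 ⟨i, hi⟩))
  unfold wt at h
  have h2 : (Finset.univ.filter (fun j : ↥S => c j ≠ 0)).card ≤ B.card := by
    apply Finset.card_le_card_of_injOn (fun j : ↥S => (j : Fin n))
    · intro j hj
      have hj' : c j ≠ 0 := by simpa using hj
      by_contra hb
      exact hj' (hz j j.2 hb)
    · intro a _ b _ hab
      exact Subtype.ext hab
  have h3 := h.trans h2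
  omega

theorem KK_group {n : ℕ} {F : Type*} [Field F] (C : Submodule F (Fin n → F))
    (R : Finset (Finset (Fin n))) (hLRC : IsLRC C 2 3 R) (S : Finset (Fin n)) (hS : S ∈ R)
    (T : Finset (Fin n)) :
    KK C (T ∪ S) = KK C T ∨
      Module.finrank F (KK C T) + 2 ≤ Module.finrank F (KK C (T ∪ S)) + (S \ T).card := by
  have key : ∀ B : Finset (Fin n), B.card ≤ 2 → KK C (T ∪ ((S \ T) \ B)) = KK C (T ∪ S) := by
    intro B hB
    apply le_antisymm
    · intro c hc
      rw [mem_KK] at hc ⊢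
      refine ⟨hc.1, fun i hi => ?_⟩
      rcases Finset.mem_union.1 hi with hi | hi
      · exact hc.2 i (Finset.mem_union_left _ hi)
      · refine group_zero C R hLRC S hS B hB c hc.1 (fun j hj hjB => hc.2 j ?_) i hi
        by_cases hjT : j ∈ T <;> simp [hj, hjB, hjT]
    · apply KK_anti
      intro j hj
      simp only [Finset.mem_union, Finset.mem_sdiff] at hj ⊢
      tauto
  by_cases h : (S \ T).card ≤ 2
  · left
    have := key (S \ T) h
    simpa using this.symm
  · right
    obtain ⟨B, hBS, hB⟩ := Finset.exists_subset_card_eq (show 2 ≤ (S \ T).card by omega)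
    have h1 := key B hB.le
    have h2 := KK_union C T ((S \ T) \ B)
    rw [h1, Finset.card_sdiff_of_subset hBS] at h2
    omega

theorem claim1 {n ℓ : ℕ} {F : Type*} [Field F] (C : Submodule F (Fin n → F))
    (R : Finset (Finset (Fin n))) (hLRC : IsLRC C 2 3 R) (hn : n = 4 * ℓ + 1)
    (hB : ∀ T : Finset (Fin n), 1 ≤ Module.finrank F (KK C T) → T.card + 4 ≤ n) :
    ∀ m, ∀ T : Finset (Fin n), Module.finrank F (KK C T) = m → 1 ≤ m →
      4 * ℓ + 1 ≤ T.card + 2 * m → False := by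
  intro m
  induction m using Nat.strong_induction_on with
  | _ m ih =>
    intro T hT hm hf
    have hb := hB T (by omega)
    have hne : KK C T ≠ ⊥ := by
      intro h
      rw [h] at hT
      simp at hT
      omega
    obtain ⟨c, hc, hc0⟩ := Submodule.exists_mem_ne_zero_of_ne_bot hne
    obtain ⟨i, hi⟩ := Function.ne_iff.1 hc0
    have hiT : i ∉ T := fun h => hi (((mem_KK C T c).1 hc).2 i h)
    rcases (show m = 1 ∨ m = 2 ∨ 3 ≤ m by omega) with h | h | h
    · omega
    · have h1 := KK_insert C T i
      have h2 := hB (insert i T) (by omega)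
      rw [Finset.card_insert_of_notMem hiT] at h2
      omega
    · obtain ⟨S, hS, hiS⟩ := hLRC.1 i
      have hle : KK C (T ∪ S) ≤ KK C T := KK_anti C Finset.subset_union_left
      have hneq : KK C (T ∪ S) ≠ KK C T := by
        intro he
        rw [← he, mem_KK] at hc
        exact hi (hc.2 i (Finset.mem_union_right _ hiS))
      have hlt := Submodule.finrank_lt_finrank_of_lt (lt_of_le_of_ne hle hneq)
      have hg := (KK_group C R hLRC S hS T).resolve_left hneq
      have h4 := hLRC.2.1 S hS
      have h5 : (S \ T).card ≤ S.card := Finset.card_le_card Finset.sdiff_subset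
      have h6 : (T ∪ S).card = (S \ T).card + T.card := by
        rw [Finset.union_comm, ← Finset.card_sdiff_add_card]
      exact ih _ (by omega) (T ∪ S) rfl (by omega) (by omega)

theorem stmt_13 (n ℓ : ℕ) (hℓ : 2 ≤ ℓ)
    (C : Submodule (GaloisField 2 2) (Fin n → GaloisField 2 2))
    (R : Finset (Finset (Fin n)))
    (hLRC : IsLRC C 2 3 R) (hnz : NoZeroCoord C)
    (hopt : SingletonOptimal C 2 3)
    (hk : Module.finrank (GaloisField 2 2) C = 2 * ℓ)
    (hd : minDist C = 4) : False := by
  have hn : n = 4 * ℓ + 1 := by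
    unfold SingletonOptimal at hopt
    rw [hd, hk, Fintype.card_fin, show (2 * ℓ + 2 - 1) / 2 = ℓ by omega] at hopt
    push_cast at hopt
    omega
  have hB : ∀ T : Finset (Fin n), 1 ≤ Module.finrank (GaloisField 2 2) (KK C T) →
      T.card + 4 ≤ n := by
    intro T hT
    have hne : KK C T ≠ ⊥ := by
      intro h
      rw [h] at hT
      simp at hT
    obtain ⟨c, hc, hc0⟩ := Submodule.exists_mem_ne_zero_of_ne_bot hne
    rw [mem_KK] at hc
    have hw : 4 ≤ wt c := by
      rw [← hd]
      exact Nat.sInf_le ⟨c, hc.1, hc0, rfl⟩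
    have h2 : wt c ≤ Tᶜ.card := by
      unfold wt
      apply Finset.card_le_card
      intro j hj
      rw [Finset.mem_compl]
      intro hjT
      exact (Finset.mem_filter.1 hj).2 (hc.2 j hjT)
    rw [Finset.card_compl, Fintype.card_fin] at h2
    omega
  have hcl := claim1 C R hLRC hn hB
  have hemp : KK C ∅ = C := by
    ext c
    simp [mem_KK]
  have hgrp : ∀ S ∈ R, S.Nonempty →
      S.card = 4 ∧ Module.finrank (GaloisField 2 2) (KK C S) = 2 * ℓ - 2 := by
    rintro S hS ⟨i, hi⟩
    have hneq : KK C (∅ ∪ S) ≠ KK C ∅ := by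
      intro he
      rw [hemp] at he
      obtain ⟨c, hc, hci⟩ := hnz i
      rw [← he, mem_KK] at hc
      exact hci (hc.2 i (by simpa using hi))
    have hg := (KK_group C R hLRC S hS ∅).resolve_left hneq
    rw [hemp, hk, Finset.empty_union, Finset.sdiff_empty] at hg
    have h4 := hLRC.2.1 S hS
    by_contra hcon
    exact hcl _ S rfl (by omega) (by omega)
  have hdisj : ∀ S ∈ R, S.Nonempty → ∀ S' ∈ R, S'.Nonempty → S ≠ S' → Disjoint S S' := by
    intro S hS hSn S' hS' hSn' hne
    obtain ⟨h1, h2⟩ := hgrp S hS hSn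
    obtain ⟨h1', h2'⟩ := hgrp S' hS' hSn'
    have h6 : (S ∪ S').card = (S' \ S).card + S.card := by
      rw [Finset.union_comm, ← Finset.card_sdiff_add_card]
    have hpos : 1 ≤ (S' \ S).card := by
      rw [Nat.one_le_iff_ne_zero, Ne, Finset.card_eq_zero, Finset.sdiff_eq_empty_iff_subset]
      intro hsub
      exact hne (Finset.eq_of_subset_of_card_le hsub (by omega)).symm
    rcases KK_group C R hLRC S' hS' S with h | h
    · exact (hcl _ (S ∪ S') rfl (by rw [h]; omega) (by rw [h]; omega)).elim
    · by_cases h3 : (S' \ S).card ≤ 3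
      · exact (hcl _ (S ∪ S') rfl (by omega) (by omega)).elim
      · have h7 : S' \ S = S' :=
          Finset.eq_of_subset_of_card_le Finset.sdiff_subset (by omega)
        exact (Finset.sdiff_eq_self_iff_disjoint.1 h7).symm
  have hcov : (R.filter (fun S => S.Nonempty)).biUnion id = Finset.univ := by
    ext i
    obtain ⟨S, hS, hi⟩ := hLRC.1 i
    simp only [Finset.mem_biUnion, Finset.mem_filter, id, Finset.mem_univ, iff_true]
    exact ⟨S, ⟨hS, i, hi⟩, hi⟩
  have hcard : ((R.filter (fun S => S.Nonempty)).biUnion id).card =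
      ∑ S ∈ R.filter (fun S => S.Nonempty), (id S).card := by
    apply Finset.card_biUnion
    intro S hS S' hS' hne
    rw [Finset.mem_coe, Finset.mem_filter] at hS hS'
    exact hdisj S hS.1 hS.2 S' hS'.1 hS'.2 hne
  rw [hcov, Finset.card_univ, Fintype.card_fin,
    Finset.sum_const_nat (m := 4) (fun S hS => by
      rw [Finset.mem_filter] at hS
      exact (hgrp S hS.1 hS.2).1)] at hcard
  omega
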